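/- Σ[3] = 𝒮[3] ∩ ℛ³: the orbit of Δ[3] ∪ Δ[3]' under H∞[3] is exactly the set of unit vectors of ℝ³ all of whose coordinates lie in ℛ. Moreover, identifying ℝ³ with the subspace V = {0} × ℝ³ of ℝ⁴, one has Σ[3] = Σ[4] ∩ V. -/

import Mathlib

noncomputable section

/-- The golden ratio τ = (1+√5)/2. -/
def gr : ℝ := (1 + Real.sqrt 5) / 2

/-- ℛ = ℤ[1/2, τ], the ring of dyadic golden numbers, as a subset of ℝ. -/
def Rgold : Set ℝ := {x : ℝ | ∃ (a b : ℤ) (n : ℕ), x = ((a : ℝ) + (b : ℝ) * gr) / 2 ^ n}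

/-- The H₄ root system with parameter t (t = τ gives Δ[4], t = 1-τ = τ' gives Δ[4]'). -/
def DeltaSet (t : ℝ) : Set (Fin 4 → ℝ) :=
  {x | (∃ i, (x i = 1 ∨ x i = -1) ∧ ∀ j, j ≠ i → x j = 0)
    ∨ (∀ i, x i = 1/2 ∨ x i = -1/2)
    ∨ (∃ σ : Equiv.Perm (Fin 4), Equiv.Perm.sign σ = 1 ∧
        ∃ ε : Fin 4 → ℝ, (∀ i, ε i = 1 ∨ ε i = -1) ∧
          ∀ i, x i = ε i * (![0, 1, 1 - t, t] (σ i)) / 2)}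

/-- The H₃ root system with parameter t (t = τ gives Δ[3], t = 1-τ = τ' gives Δ[3]'):
the 6 vectors (±1,0,0) and permutations, and the 24 vectors obtained from
½(±1,±τ',±τ) by cyclic (= even) permutations of the coordinates. -/
def Delta3 (t : ℝ) : Set (Fin 3 → ℝ) :=
  {x | (∃ i, (x i = 1 ∨ x i = -1) ∧ ∀ j, j ≠ i → x j = 0)
    ∨ (∃ σ : Equiv.Perm (Fin 3), Equiv.Perm.sign σ = 1 ∧
        ∃ ε : Fin 3 → ℝ, (∀ i, ε i = 1 ∨ ε i = -1) ∧
          ∀ i, x i = ε i * (![1, 1 - t, t] (σ i)) / 2)}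

/-- The matrix of the reflection `x ↦ x - 2(x·a)a` in the standard basis (dimension 4). -/
def reflMat (a : Fin 4 → ℝ) : Matrix (Fin 4) (Fin 4) ℝ :=
  Matrix.of fun i j => (if i = j then (1 : ℝ) else 0) - 2 * a i * a j

/-- The matrix of the reflection `x ↦ x - 2(x·a)a` in the standard basis (dimension 3). -/
def reflMat3 (a : Fin 3 → ℝ) : Matrix (Fin 3) (Fin 3) ℝ :=
  Matrix.of fun i j => (if i = j then (1 : ℝ) else 0) - 2 * a i * a j

/-- H∞[4], the subgroup of O(4,ℝ) generated by the reflections in the roots of Δ[4] ∪ Δ[4]'. -/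
def HinfG : Subgroup (Matrix.orthogonalGroup (Fin 4) ℝ) :=
  Subgroup.closure {g | ∃ a ∈ DeltaSet gr ∪ DeltaSet (1 - gr),
    (g : Matrix (Fin 4) (Fin 4) ℝ) = reflMat a}

/-- H∞[3], the subgroup of O(3,ℝ) generated by the reflections in the roots of Δ[3] ∪ Δ[3]'. -/
def HinfG3 : Subgroup (Matrix.orthogonalGroup (Fin 3) ℝ) :=
  Subgroup.closure {g | ∃ a ∈ Delta3 gr ∪ Delta3 (1 - gr),
    (g : Matrix (Fin 3) (Fin 3) ℝ) = reflMat3 a}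

/-- Σ[4], the orbit of Δ[4] ∪ Δ[4]' under H∞[4]. -/
def SigmaSet : Set (Fin 4 → ℝ) :=
  {x | ∃ g ∈ HinfG, ∃ a ∈ DeltaSet gr ∪ DeltaSet (1 - gr),
    x = Matrix.mulVec (g : Matrix (Fin 4) (Fin 4) ℝ) a}

/-- Σ[3], the orbit of Δ[3] ∪ Δ[3]' under H∞[3]. -/
def SigmaSet3 : Set (Fin 3 → ℝ) :=
  {x | ∃ g ∈ HinfG3, ∃ a ∈ Delta3 gr ∪ Delta3 (1 - gr),
    x = Matrix.mulVec (g : Matrix (Fin 3) (Fin 3) ℝ) a}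

/-- The identification of ℝ³ with the subspace V = {0} × ℝ³ of ℝ⁴. -/
def emb34 (x : Fin 3 → ℝ) : Fin 4 → ℝ := ![0, x 0, x 1, x 2]

theorem gr_sq : gr ^ 2 = gr + 1 := by
  have h : Real.sqrt 5 ^ 2 = 5 := Real.sq_sqrt (by norm_num)
  unfold gr
  linear_combination h / 4

theorem irrational_gr : Irrational gr := Real.goldenRatio_irrational

/-- The numbers `1` and `τ` are linearly independent over the integers. -/
theorem int_coeffs_eq {a b c d : ℤ} (h : (a : ℝ) + b * gr = c + d * gr) : a = c ∧ b = d := by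
  have hbd : b = d := by
    by_contra hne
    have hirr := irrational_gr.intCast_mul (sub_ne_zero.2 hne)
    refine hirr ⟨((c - a : ℤ) : ℚ), ?_⟩
    push_cast
    linear_combination -h
  subst hbd
  refine ⟨?_, rfl⟩
  have : (a : ℝ) = c := by linarith
  exact_mod_cast this

/-- The ring `ℤ[1/2, τ]` as a subring of `ℝ`. -/
def goldenSubring : Subring ℝ where
  carrier := Rgold
  one_mem' := ⟨1, 0, 0, by norm_num⟩
  zero_mem' := ⟨0, 0, 0, by norm_num⟩
  neg_mem' := by
    rintro _ ⟨a, b, n, rfl⟩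
    exact ⟨-a, -b, n, by push_cast; ring⟩
  add_mem' := by
    rintro _ _ ⟨a, b, n, rfl⟩ ⟨c, d, m, rfl⟩
    refine ⟨a * 2 ^ m + c * 2 ^ n, b * 2 ^ m + d * 2 ^ n, n + m, ?_⟩
    push_cast
    field_simp
    ring
  mul_mem' := by
    rintro _ _ ⟨a, b, n, rfl⟩ ⟨c, d, m, rfl⟩
    refine ⟨a * c + b * d, a * d + b * c + b * d, n + m, ?_⟩
    push_cast
    rw [div_mul_div_comm, pow_add]
    congr 1
    linear_combination (b * d : ℝ) * gr_sq

theorem gr_mem : gr ∈ goldenSubring := ⟨0, 1, 0, by norm_num⟩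

theorem half_mem : (1 / 2 : ℝ) ∈ goldenSubring := ⟨1, 0, 1, by norm_num⟩

theorem div_two_mem {x : ℝ} (hx : x ∈ goldenSubring) : x / 2 ∈ goldenSubring := by
  rw [div_eq_mul_one_div]
  exact mul_mem hx half_mem

theorem sign_mem {ε : ℝ} (h : ε = 1 ∨ ε = -1) : ε ∈ goldenSubring := by
  rcases h with rfl | rfl
  · exact one_mem _
  · exact neg_mem (one_mem _)

theorem sign_sq {ε : ℝ} (h : ε = 1 ∨ ε = -1) : ε ^ 2 = 1 := by
  rcases h with rfl | rfl <;> norm_num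

/-- The unit vectors all of whose coordinates lie in `ℤ[1/2, τ]`. -/
def goldenSphere (n : ℕ) : Set (Fin n → ℝ) :=
  {x | ∑ i, x i ^ 2 = 1 ∧ ∀ i, x i ∈ goldenSubring}

theorem axis_mem_goldenSphere {n : ℕ} {x : Fin n → ℝ} {i : Fin n} (hi : x i = 1 ∨ x i = -1)
    (h : ∀ j, j ≠ i → x j = 0) : x ∈ goldenSphere n := by
  refine ⟨?_, fun j => ?_⟩
  · rw [Finset.sum_eq_single i (fun j _ hj => by simp [h j hj]) (by simp)]
    exact sign_sq hi
  · by_cases hj : j = i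
    · exact hj ▸ sign_mem hi
    · exact h j hj ▸ zero_mem _

theorem signed_perm_mem_goldenSphere {n : ℕ} {x ε v : Fin n → ℝ} (σ : Equiv.Perm (Fin n))
    (hε : ∀ i, ε i = 1 ∨ ε i = -1) (hx : ∀ i, x i = ε i * v (σ i) / 2)
    (hv : ∀ i, v i ∈ goldenSubring) (hsum : ∑ i, v i ^ 2 = 4) : x ∈ goldenSphere n := by
  refine ⟨?_, fun i => ?_⟩
  · have h : ∀ i, x i ^ 2 = v (σ i) ^ 2 / 4 := fun i => by
      rw [hx, div_pow, mul_pow, sign_sq (hε i)]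
      norm_num
    simp_rw [h]
    rw [← Finset.sum_div, Equiv.sum_comp σ (fun i => v i ^ 2), hsum]
    norm_num
  · rw [hx]
    exact div_two_mem (mul_mem (sign_mem (hε i)) (hv _))

theorem Delta3_subset_goldenSphere {t : ℝ} (ht : t ^ 2 = t + 1) (hmem : t ∈ goldenSubring) :
    Delta3 t ⊆ goldenSphere 3 := by
  rintro x (⟨i, hi, h⟩ | ⟨σ, -, ε, hε, hx⟩)
  · exact axis_mem_goldenSphere hi h
  · refine signed_perm_mem_goldenSphere σ hε hx (fun i => ?_) ?_
    · fin_cases i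
      exacts [one_mem _, sub_mem (one_mem _) hmem, hmem]
    · simp [Fin.sum_univ_three]
      linear_combination 2 * ht

theorem DeltaSet_subset_goldenSphere {t : ℝ} (ht : t ^ 2 = t + 1) (hmem : t ∈ goldenSubring) :
    DeltaSet t ⊆ goldenSphere 4 := by
  rintro x (⟨i, hi, h⟩ | h | ⟨σ, -, ε, hε, hx⟩)
  · exact axis_mem_goldenSphere hi h
  · refine ⟨?_, fun i => ?_⟩
    · have hsq : ∀ i, x i ^ 2 = 1 / 4 := fun i => by rcases h i with h | h <;> rw [h] <;> norm_num
      simp [hsq]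
    · rcases h i with h | h <;> rw [h]
      · exact half_mem
      · exact div_two_mem (neg_mem (one_mem _))
  · refine signed_perm_mem_goldenSphere σ hε hx (fun i => ?_) ?_
    · fin_cases i
      exacts [zero_mem _, one_mem _, sub_mem (one_mem _) hmem, hmem]
    · simp [Fin.sum_univ_four]
      linear_combination 2 * ht

theorem one_sub_gr_sq : (1 - gr) ^ 2 = (1 - gr) + 1 := by
  linear_combination gr_sq

theorem one_sub_gr_mem : 1 - gr ∈ goldenSubring := sub_mem (one_mem _) gr_mem

theorem roots3_subset_goldenSphere : Delta3 gr ∪ Delta3 (1 - gr) ⊆ goldenSphere 3 :=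
  Set.union_subset (Delta3_subset_goldenSphere gr_sq gr_mem)
    (Delta3_subset_goldenSphere one_sub_gr_sq one_sub_gr_mem)

theorem roots4_subset_goldenSphere : DeltaSet gr ∪ DeltaSet (1 - gr) ⊆ goldenSphere 4 :=
  Set.union_subset (DeltaSet_subset_goldenSphere gr_sq gr_mem)
    (DeltaSet_subset_goldenSphere one_sub_gr_sq one_sub_gr_mem)

/-- The matrix of the reflection `x ↦ x - 2(x·a)a` in any dimension. -/
def reflMatrix {n : ℕ} (a : Fin n → ℝ) : Matrix (Fin n) (Fin n) ℝ :=
  Matrix.of fun i j => (if i = j then (1 : ℝ) else 0) - 2 * a i * a j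

theorem reflMatrix_mulVec {n : ℕ} (a x : Fin n → ℝ) (i : Fin n) :
    (reflMatrix a).mulVec x i = x i - 2 * (∑ j, a j * x j) * a i := by
  simp only [reflMatrix, Matrix.mulVec, dotProduct, Matrix.of_apply, sub_mul, ite_mul, one_mul,
    zero_mul, Finset.sum_sub_distrib, Finset.sum_ite_eq, Finset.mem_univ, if_true,
    Finset.mul_sum, Finset.sum_mul]
  congr 1
  exact Finset.sum_congr rfl fun j _ => by ring

theorem reflMatrix_mulVec_self {n : ℕ} {a : Fin n → ℝ} (ha : ∑ i, a i ^ 2 = 1) (x : Fin n → ℝ) :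
    (reflMatrix a).mulVec ((reflMatrix a).mulVec x) = x := by
  ext i
  simp_rw [reflMatrix_mulVec, mul_sub, Finset.sum_sub_distrib]
  have h : ∑ j, a j * (2 * (∑ k, a k * x k) * a j) = 2 * (∑ k, a k * x k) := by
    generalize 2 * ∑ k, a k * x k = c
    refine Eq.trans ?_ ((congrArg (c * ·) ha).trans (mul_one c))
    simp only [Finset.mul_sum]
    exact Finset.sum_congr rfl fun j _ => by ring
  rw [h]
  ring

theorem sum_sq_mulVec_orthogonal {n : ℕ} {M : Matrix (Fin n) (Fin n) ℝ}
    (hM : M ∈ Matrix.orthogonalGroup (Fin n) ℝ) (x : Fin n → ℝ) :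
    ∑ i, M.mulVec x i ^ 2 = ∑ i, x i ^ 2 := by
  have hsq : ∀ y : Fin n → ℝ, ∑ i, y i ^ 2 = dotProduct y y := fun y =>
    Finset.sum_congr rfl fun i _ => sq _
  rw [hsq, hsq, Matrix.dotProduct_mulVec, Matrix.vecMul_mulVec,
    (Matrix.mem_orthogonalGroup_iff' _ _).1 hM, Matrix.vecMul_one]

theorem reflMatrix_mem_orthogonalGroup {n : ℕ} {a : Fin n → ℝ} (ha : ∑ i, a i ^ 2 = 1) :
    reflMatrix a ∈ Matrix.orthogonalGroup (Fin n) ℝ := by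
  have hT : (reflMatrix a).transpose = reflMatrix a := by
    ext i j
    simp only [Matrix.transpose_apply, reflMatrix, Matrix.of_apply, eq_comm (a := i)]
    ring
  rw [Matrix.mem_orthogonalGroup_iff, hT]
  refine Matrix.mulVec_injective (funext fun x => ?_)
  rw [← Matrix.mulVec_mulVec, reflMatrix_mulVec_self ha, Matrix.one_mulVec]

theorem reflMatrix_apply_mem {n : ℕ} {a : Fin n → ℝ} (ha : ∀ i, a i ∈ goldenSubring)
    (i j : Fin n) : reflMatrix a i j ∈ goldenSubring := by
  refine sub_mem ?_ (mul_mem (mul_mem (ofNat_mem _ 2) (ha i)) (ha j))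
  split_ifs
  exacts [one_mem _, zero_mem _]

/-- A group generated by reflections in golden unit vectors preserves the golden sphere. -/
theorem mulVec_mem_goldenSphere {n : ℕ} {S : Set (Fin n → ℝ)} (hS : S ⊆ goldenSphere n)
    {g : Matrix.orthogonalGroup (Fin n) ℝ}
    (hg : g ∈ Subgroup.closure {g : Matrix.orthogonalGroup (Fin n) ℝ | ∃ a ∈ S,
      (g : Matrix (Fin n) (Fin n) ℝ) = reflMatrix a})
    {x : Fin n → ℝ} (hx : x ∈ goldenSphere n) :
    (g : Matrix (Fin n) (Fin n) ℝ).mulVec x ∈ goldenSphere n := by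
  refine ⟨(sum_sq_mulVec_orthogonal g.2 x).trans hx.1, fun i => ?_⟩
  have hentry : ∀ i j, (g : Matrix (Fin n) (Fin n) ℝ) i j ∈ goldenSubring := by
    induction hg using Subgroup.closure_induction with
    | mem g hg =>
      obtain ⟨a, ha, hga⟩ := hg
      intro i j
      rw [hga]
      exact reflMatrix_apply_mem (hS ha).2 i j
    | one =>
      intro i j
      rw [OneMemClass.coe_one, Matrix.one_apply]
      split_ifs
      exacts [one_mem _, zero_mem _]
    | mul g h _ _ hg hh =>
      intro i j
      rw [Submonoid.coe_mul, Matrix.mul_apply]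
      exact sum_mem fun k _ => mul_mem (hg i k) (hh k j)
    | inv g _ hg => exact fun i j => hg j i
  rw [Matrix.mulVec, dotProduct]
  exact sum_mem fun j _ => mul_mem (hentry i j) (hx.2 j)

theorem SigmaSet3_subset_goldenSphere : SigmaSet3 ⊆ goldenSphere 3 := by
  rintro _ ⟨g, hg, a, ha, rfl⟩
  exact mulVec_mem_goldenSphere roots3_subset_goldenSphere hg (roots3_subset_goldenSphere ha)

theorem SigmaSet_subset_goldenSphere : SigmaSet ⊆ goldenSphere 4 := by
  rintro _ ⟨g, hg, a, ha, rfl⟩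
  exact mulVec_mem_goldenSphere roots4_subset_goldenSphere hg (roots4_subset_goldenSphere ha)

theorem mem_SigmaSet3_of_reflMatrix {a x : Fin 3 → ℝ} (ha : a ∈ Delta3 gr ∪ Delta3 (1 - gr))
    (hx : (reflMatrix a).mulVec x ∈ SigmaSet3) : x ∈ SigmaSet3 := by
  have hunit := (roots3_subset_goldenSphere ha).1
  obtain ⟨g, hg, b, hb, hgb⟩ := hx
  refine ⟨⟨reflMatrix a, reflMatrix_mem_orthogonalGroup hunit⟩ * g,
    mul_mem (Subgroup.subset_closure ⟨a, ha, rfl⟩) hg, b, hb, ?_⟩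
  rw [Submonoid.coe_mul, ← Matrix.mulVec_mulVec, ← hgb]
  exact (reflMatrix_mulVec_self hunit x).symm

/-- Signs can be chosen in `(±1, ±(1 - t), ±t)` so that the reflection in half of this vector maps
`(1, 1 - t, t) + 2c` to twice an integral vector. -/
theorem exists_signs {t : ℝ} (ht : t ^ 2 = t + 1) (p q : Fin 3 → ℤ) {y : Fin 3 → ℝ}
    (hy : ∀ i, y i = ![1, 1 - t, t] i + 2 * (p i + q i * t)) :
    ∃ ε : Fin 3 → ℝ, (∀ i, ε i = 1 ∨ ε i = -1) ∧ ∃ r s : Fin 3 → ℤ, ∀ i,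
      y i - (∑ j, ε j * ![1, 1 - t, t] j * y j) / 2 * (ε i * ![1, 1 - t, t] i) =
        2 * (r i + s i * t) := by
  have key : ∀ e : Fin 3 → ℤ, (∀ i, e i = 1 ∨ e i = -1) → ∀ u v : ℤ,
      (∑ j, (e j : ℝ) * ![1, 1 - t, t] j * y j) = 2 * ((1 + 2 * u) + 2 * v * t) →
      ∃ ε : Fin 3 → ℝ, (∀ i, ε i = 1 ∨ ε i = -1) ∧ ∃ r s : Fin 3 → ℤ, ∀ i,
      y i - (∑ j, ε j * ![1, 1 - t, t] j * y j) / 2 * (ε i * ![1, 1 - t, t] i) =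
        2 * (r i + s i * t) := by
    intro e he u v hsum
    choose f hf using fun i => show ∃ f : ℤ, 1 - e i = 2 * f by
      rcases he i with h | h
      · exact ⟨0, by omega⟩
      · exact ⟨1, by omega⟩
    refine ⟨fun i => e i, fun i => by rcases he i with h | h <;> simp [h],
      ![p 0 + f 0 - e 0 * u, p 1 + f 1 - e 1 * (u - v), p 2 - e 2 * v],
      ![q 0 - e 0 * v, q 1 - f 1 + e 1 * u, q 2 + f 2 - e 2 * (u + v)], fun i => ?_⟩
    have hfi : (1 - e i : ℝ) = 2 * f i := by exact_mod_cast hf i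
    rw [hsum, hy]
    fin_cases i <;> simp at hfi ⊢
    · linear_combination hfi
    · linear_combination (1 - t) * hfi + (2 * e 1 * v : ℝ) * ht
    · linear_combination t * hfi - (2 * e 2 * v : ℝ) * ht
  simp only [Fin.sum_univ_three] at key ⊢
  have h0 := hy 0
  have h1 := hy 1
  have h2 := hy 2
  simp at h0 h1 h2
  -- The dot product `c · (1, 1 - t, t)` is `m + l * t`.
  obtain ⟨m, hm⟩ : ∃ m : ℤ, m = p 0 + (p 1 - q 1) + q 2 := ⟨_, rfl⟩
  obtain ⟨l, hl⟩ : ∃ l : ℤ, l = q 0 - p 1 + (p 2 + q 2) := ⟨_, rfl⟩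
  have hm' : (m : ℝ) = p 0 + (p 1 - q 1) + q 2 := by exact_mod_cast hm
  have hl' : (l : ℝ) = q 0 - p 1 + (p 2 + q 2) := by exact_mod_cast hl
  rcases Int.even_or_odd' m with ⟨m₂, h | h⟩ <;> rcases Int.even_or_odd' l with ⟨l₂, h' | h'⟩ <;>
    (rw [h] at hm'; rw [h'] at hl'; push_cast at hm' hl')
  · refine key ![-1, 1, 1] (by decide) (m₂ - p 0) (l₂ - q 0) ?_
    simp [h0, h1, h2]
    linear_combination -2 * hm' - 2 * t * hl' + (2 - 2 * q 1 + 2 * q 2 : ℝ) * ht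
  · refine key ![1, 1, -1] (by decide) (m₂ - q 2) (l₂ - (p 2 + q 2)) ?_
    simp [h0, h1, h2]
    linear_combination -2 * hm' - 2 * t * hl' + (-2 * q 1 - 2 * q 2 : ℝ) * ht
  · refine key ![1, 1, 1] (by decide) (m₂ + 1) l₂ ?_
    simp [h0, h1, h2]
    linear_combination -2 * hm' - 2 * t * hl' + (2 - 2 * q 1 + 2 * q 2 : ℝ) * ht
  · refine key ![1, -1, 1] (by decide) (m₂ - (p 1 - q 1)) (l₂ + 1 + p 1) ?_
    simp [h0, h1, h2]
    linear_combination -2 * hm' - 2 * t * hl' + (2 * q 1 + 2 * q 2 : ℝ) * ht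

/-- If `2 ^ (n + 1) * x` is congruent modulo `2` to an even permutation of `(1, 1 - t, t)`, then some
reflection lowers the exponent of the denominator of `x`. -/
theorem exists_reflection {t : ℝ} (ht : t ^ 2 = t + 1) {σ : Equiv.Perm (Fin 3)}
    (hσ : Equiv.Perm.sign σ = 1) (n : ℕ) (p q : Fin 3 → ℤ) {x : Fin 3 → ℝ}
    (hx : ∀ i, 2 ^ (n + 1) * x i = ![1, 1 - t, t] (σ i) + 2 * (p i + q i * t)) :
    ∃ a ∈ Delta3 t, ∃ r s : Fin 3 → ℤ,
      ∀ i, 2 ^ n * (reflMatrix a).mulVec x i = r i + s i * t := by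
  obtain ⟨ε, hε, r, s, hrs⟩ := exists_signs ht (fun k => p (σ.symm k)) (fun k => q (σ.symm k))
    (y := fun k => 2 ^ (n + 1) * x (σ.symm k)) (fun k => by rw [hx, σ.apply_symm_apply])
  refine ⟨fun i => ε (σ i) * ![1, 1 - t, t] (σ i) / 2,
    Or.inr ⟨σ, hσ, fun i => ε (σ i), fun i => hε _, fun i => rfl⟩,
    fun i => r (σ i), fun i => s (σ i), fun i => ?_⟩
  have hi := hrs (σ i)
  have hdot : ∑ j, ε j * ![1, 1 - t, t] j * (2 ^ (n + 1) * x (σ.symm j)) =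
      2 ^ (n + 2) * ∑ j, ε (σ j) * ![1, 1 - t, t] (σ j) / 2 * x j := by
    rw [← Equiv.sum_comp σ, Finset.mul_sum]
    refine Finset.sum_congr rfl fun j _ => ?_
    rw [σ.symm_apply_apply]
    ring
  simp only [hdot, σ.symm_apply_apply] at hi
  rw [reflMatrix_mulVec]
  linear_combination hi / 2

/-- The norm condition modulo `4` forces a vector over `ℤ[τ]`, unless divisible by `2`, to be
congruent modulo `2` to a permutation of `(1, 1 - τ, τ)`. Here `α i + β i τ` are the residues. -/
theorem parity_cases : ∀ α β : Fin 3 → Bool,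
    (4 : ℤ) ∣ ∑ i, ((α i).toInt + (β i).toInt) →
    (4 : ℤ) ∣ ∑ i, (2 * (α i).toInt * (β i).toInt + (β i).toInt) →
    (∀ i, α i = false ∧ β i = false) ∨ ∃ σ : Equiv.Perm (Fin 3), Equiv.Perm.sign σ = 1 ∧
      ((∀ i, (α i, β i) = ![(true, false), (true, true), (false, true)] (σ i)) ∨
        (∀ i, (α i, β i) = ![(true, false), (false, true), (true, true)] (σ i))) := by
  decide +kernel

theorem exists_bool_residue (a : ℤ) : ∃ (k : ℤ) (α : Bool), a = 2 * k + α.toInt := by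
  rcases Int.even_or_odd' a with ⟨k, h | h⟩
  · exact ⟨k, false, by simpa using h⟩
  · exact ⟨k, true, by simpa using h⟩

theorem int_norm_eq {a b : Fin 3 → ℤ} {m : ℤ} (h : ∑ i, (a i + b i * gr) ^ 2 = (m : ℝ)) :
    ∑ i, (a i ^ 2 + b i ^ 2) = m ∧ ∑ i, (2 * a i * b i + b i ^ 2) = 0 := by
  refine int_coeffs_eq ?_
  rw [← sub_eq_zero] at h ⊢
  push_cast
  rw [Finset.sum_mul, ← Finset.sum_add_distrib, zero_mul, add_zero, ← h]
  congr 1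
  exact Finset.sum_congr rfl fun i _ => by linear_combination -(b i : ℝ) ^ 2 * gr_sq

theorem root_mem_SigmaSet3 {a : Fin 3 → ℝ} (ha : a ∈ Delta3 gr ∪ Delta3 (1 - gr)) :
    a ∈ SigmaSet3 :=
  ⟨1, one_mem _, a, ha, by simp⟩

theorem exists_axis_of_int_norm_eq_one {a b : Fin 3 → ℤ} (h₁ : ∑ i, (a i ^ 2 + b i ^ 2) = 1)
    (h₂ : ∑ i, (2 * a i * b i + b i ^ 2) = 0) :
    (∀ i, b i = 0) ∧ ∃ i, (a i = 1 ∨ a i = -1) ∧ ∀ j, j ≠ i → a j = 0 := by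
  obtain ⟨i, hi⟩ : ∃ i, a i ≠ 0 := by
    by_contra! h
    simp only [h] at h₁ h₂
    simp at h₁ h₂
    omega
  rw [← Finset.add_sum_erase _ _ (Finset.mem_univ i)] at h₁
  have hnonneg : ∀ j ∈ Finset.univ.erase i, 0 ≤ a j ^ 2 + b j ^ 2 := fun j _ => by positivity
  have hrest := Finset.sum_nonneg hnonneg
  have ha : 0 < a i ^ 2 := by positivity
  have hb : 0 ≤ b i ^ 2 := sq_nonneg _
  have hzero := (Finset.sum_eq_zero_iff_of_nonneg hnonneg).1 (by omega)
  have hj : ∀ j, j ≠ i → a j = 0 ∧ b j = 0 := fun j hj => by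
    have := hzero j (by simp [hj])
    constructor <;> nlinarith [sq_nonneg (a j), sq_nonneg (b j)]
  refine ⟨fun j => ?_, i, sq_eq_one_iff.1 (by omega), fun j h => (hj j h).1⟩
  by_cases h : j = i
  · exact h ▸ sq_eq_zero_iff.1 (by omega : b i ^ 2 = 0)
  · exact (hj j h).2

theorem mem_SigmaSet3_of_denominator (n : ℕ) : ∀ {x : Fin 3 → ℝ}, ∑ i, x i ^ 2 = 1 →
    ∀ {a b : Fin 3 → ℤ}, (∀ i, 2 ^ n * x i = a i + b i * gr) → x ∈ SigmaSet3 := by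
  induction n with
  | zero =>
    intro x hx a b hab
    simp only [pow_zero, one_mul] at hab
    simp_rw [hab] at hx
    obtain ⟨h₁, h₂⟩ := int_norm_eq (m := 1) (by exact_mod_cast hx)
    obtain ⟨hb, i, hi, hj⟩ := exists_axis_of_int_norm_eq_one h₁ h₂
    refine root_mem_SigmaSet3 (Or.inl (Or.inl ⟨i, ?_, fun j h => ?_⟩))
    · rcases hi with h | h <;> simp [hab, hb, h]
    · simp [hab, hb, hj j h]
  | succ n ih =>
    intro x hx a b hab
    have hnorm : ∑ i, ((a i : ℝ) + b i * gr) ^ 2 = ((4 ^ (n + 1) : ℤ) : ℝ) := by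
      simp_rw [← hab, mul_pow, ← Finset.mul_sum, hx]
      push_cast
      rw [mul_one, ← pow_mul, mul_comm, pow_mul]
      norm_num
    obtain ⟨h₁, h₂⟩ := int_norm_eq hnorm
    choose k α hα using fun i => exists_bool_residue (a i)
    choose l β hβ using fun i => exists_bool_residue (b i)
    have hsq : ∀ c : Bool, c.toInt ^ 2 = c.toInt := by decide
    have hd₁ : (4 : ℤ) ∣ ∑ i, ((α i).toInt + (β i).toInt) := by
      have h4 : (4 : ℤ) ∣ ∑ i, (a i ^ 2 + b i ^ 2) := h₁ ▸ dvd_pow_self 4 n.succ_ne_zero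
      rw [← dvd_sub_right h4, ← Finset.sum_sub_distrib]
      refine Finset.dvd_sum fun i _ =>
        ⟨k i ^ 2 + k i * (α i).toInt + l i ^ 2 + l i * (β i).toInt, ?_⟩
      rw [hα, hβ]
      linear_combination hsq (α i) + hsq (β i)
    have hd₂ : (4 : ℤ) ∣ ∑ i, (2 * (α i).toInt * (β i).toInt + (β i).toInt) := by
      have h4 : (4 : ℤ) ∣ ∑ i, (2 * a i * b i + b i ^ 2) := h₂ ▸ dvd_zero 4
      rw [← dvd_sub_right h4, ← Finset.sum_sub_distrib]
      refine Finset.dvd_sum fun i _ => ⟨2 * k i * l i + k i * (β i).toInt + l i * (α i).toInt +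
        l i ^ 2 + l i * (β i).toInt, ?_⟩
      rw [hα, hβ]
      linear_combination hsq (β i)
    have descend : ∀ {y : Fin 3 → ℝ}, y ∈ Delta3 gr ∪ Delta3 (1 - gr) →
        ∀ {r s : Fin 3 → ℤ}, (∀ i, 2 ^ n * (reflMatrix y).mulVec x i = r i + s i * gr) →
        x ∈ SigmaSet3 := by
      intro y hy r s hrs
      refine mem_SigmaSet3_of_reflMatrix hy (ih ?_ hrs)
      exact (sum_sq_mulVec_orthogonal (reflMatrix_mem_orthogonalGroup
        (roots3_subset_goldenSphere hy).1) x).trans hx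
    rcases parity_cases α β hd₁ hd₂ with h | ⟨σ, hσ, h | h⟩
    · refine ih hx (a := k) (b := l) fun i => ?_
      have hi := hab i
      rw [hα, hβ, (h i).1, (h i).2] at hi
      simp at hi
      linear_combination hi / 2
    · have hpq : ∀ i, ∃ p q : ℤ,
          2 ^ (n + 1) * x i = ![1, 1 - gr, gr] (σ i) + 2 * (p + q * gr) := by
        intro i
        have hi := h i
        rw [hab, hα, hβ]
        generalize σ i = j at hi
        fin_cases j <;> simp at hi <;> simp only [hi.1, hi.2]
        · exact ⟨k i, l i, by simp; ring⟩
        · exact ⟨k i, l i + 1, by simp; ring⟩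
        · exact ⟨k i, l i, by simp; ring⟩
      choose p q hpq using hpq
      obtain ⟨y, hy, r, s, hrs⟩ := exists_reflection gr_sq hσ n p q hpq
      exact descend (Or.inl hy) hrs
    · have hpq : ∀ i, ∃ p q : ℤ, 2 ^ (n + 1) * x i =
          ![1, 1 - (1 - gr), 1 - gr] (σ i) + 2 * (p + q * (1 - gr)) := by
        intro i
        have hi := h i
        rw [hab, hα, hβ]
        generalize σ i = j at hi
        fin_cases j <;> simp at hi <;> simp only [hi.1, hi.2]
        · exact ⟨k i + l i, -l i, by simp; ring⟩
        · exact ⟨k i + l i, -l i, by simp; ring⟩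
        · exact ⟨k i + l i + 1, -l i - 1, by simp; ring⟩
      choose p q hpq using hpq
      obtain ⟨y, hy, r, s, hrs⟩ := exists_reflection one_sub_gr_sq hσ n p q hpq
      refine descend (Or.inr hy) (r := fun i => r i + s i) (s := fun i => -s i) fun i => ?_
      rw [hrs]
      push_cast
      ring

theorem goldenSphere_subset_SigmaSet3 : goldenSphere 3 ⊆ SigmaSet3 := by
  rintro x ⟨hx, hmem⟩
  choose a b n hab using hmem
  have hle : ∀ i, n i ≤ ∑ j, n j := fun i =>
    Finset.single_le_sum (fun _ _ => Nat.zero_le _) (Finset.mem_univ i)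
  refine mem_SigmaSet3_of_denominator (∑ j, n j) hx (a := fun i => 2 ^ (∑ j, n j - n i) * a i)
    (b := fun i => 2 ^ (∑ j, n j - n i) * b i) fun i => ?_
  rw [← Nat.sub_add_cancel (hle i), pow_add, Nat.add_sub_cancel, hab]
  push_cast
  field_simp

theorem SigmaSet3_eq_goldenSphere : SigmaSet3 = goldenSphere 3 :=
  SigmaSet3_subset_goldenSphere.antisymm goldenSphere_subset_SigmaSet3

theorem emb34_eq_cons (x : Fin 3 → ℝ) : emb34 x = Fin.cons 0 x := by
  ext i
  fin_cases i <;> rfl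

theorem emb34_mem_DeltaSet {t : ℝ} {x : Fin 3 → ℝ} (hx : x ∈ Delta3 t) :
    emb34 x ∈ DeltaSet t := by
  rw [emb34_eq_cons]
  obtain ⟨i, hi, h⟩ | ⟨σ, hσ, ε, hε, hx⟩ := hx
  · refine Or.inl ⟨i.succ, hi, fun j => ?_⟩
    refine Fin.cases (fun _ => rfl) (fun j hj => h j fun hji => hj (hji ▸ rfl)) j
  · refine Or.inr (Or.inr ⟨Equiv.Perm.decomposeFin.symm (0, σ), by simp [hσ], Fin.cons 1 ε,
      Fin.cases (Or.inl rfl) hε, Fin.cases (by simp) fun i => ?_⟩)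
    simp [hx]

theorem emb34_mem_roots {x : Fin 3 → ℝ} (hx : x ∈ Delta3 gr ∪ Delta3 (1 - gr)) :
    emb34 x ∈ DeltaSet gr ∪ DeltaSet (1 - gr) :=
  hx.imp emb34_mem_DeltaSet emb34_mem_DeltaSet

theorem reflMatrix_emb34 (a x : Fin 3 → ℝ) :
    (reflMatrix (emb34 a)).mulVec (emb34 x) = emb34 ((reflMatrix a).mulVec x) := by
  ext i
  rw [reflMatrix_mulVec]
  simp only [emb34_eq_cons]
  refine Fin.cases ?_ (fun i => ?_) i <;> simp [reflMatrix_mulVec, Fin.sum_univ_succ]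

/-- Every element of `H∞[3]` extends to an element of `H∞[4]`. -/
theorem exists_extension {g : Matrix.orthogonalGroup (Fin 3) ℝ} (hg : g ∈ HinfG3) :
    ∃ h ∈ HinfG, ∀ x, (h : Matrix (Fin 4) (Fin 4) ℝ).mulVec (emb34 x) =
      emb34 ((g : Matrix (Fin 3) (Fin 3) ℝ).mulVec x) := by
  induction hg using Subgroup.closure_induction with
  | mem g hg =>
    obtain ⟨a, ha, hga⟩ := hg
    have hroot := emb34_mem_roots ha
    refine ⟨⟨reflMatrix (emb34 a),
      reflMatrix_mem_orthogonalGroup (roots4_subset_goldenSphere hroot).1⟩,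
      Subgroup.subset_closure ⟨_, hroot, rfl⟩, fun x => ?_⟩
    rw [hga]
    exact reflMatrix_emb34 a x
  | one => exact ⟨1, one_mem _, fun x => by simp⟩
  | mul g₁ g₂ _ _ h₁ h₂ =>
    obtain ⟨h₁, hm₁, he₁⟩ := h₁
    obtain ⟨h₂, hm₂, he₂⟩ := h₂
    refine ⟨h₁ * h₂, mul_mem hm₁ hm₂, fun x => ?_⟩
    rw [Submonoid.coe_mul, Submonoid.coe_mul, ← Matrix.mulVec_mulVec, he₂, he₁,
      Matrix.mulVec_mulVec]
  | inv g _ h =>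
    obtain ⟨h, hm, he⟩ := h
    refine ⟨h⁻¹, inv_mem hm, fun x => ?_⟩
    have hx : x = (g : Matrix (Fin 3) (Fin 3) ℝ).mulVec
        (((g⁻¹ : Matrix.orthogonalGroup (Fin 3) ℝ) : Matrix (Fin 3) (Fin 3) ℝ).mulVec x) := by
      rw [Matrix.mulVec_mulVec, ← Submonoid.coe_mul, mul_inv_cancel, OneMemClass.coe_one,
        Matrix.one_mulVec]
    conv_lhs => rw [hx]
    rw [← he, Matrix.mulVec_mulVec, ← Submonoid.coe_mul, inv_mul_cancel, OneMemClass.coe_one,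
      Matrix.one_mulVec]

theorem emb34_mem_SigmaSet {x : Fin 3 → ℝ} (hx : x ∈ SigmaSet3) : emb34 x ∈ SigmaSet := by
  obtain ⟨g, hg, a, ha, rfl⟩ := hx
  obtain ⟨h, hh, he⟩ := exists_extension hg
  exact ⟨h, hh, emb34 a, emb34_mem_roots ha, (he a).symm⟩

theorem statement12 :
    SigmaSet3 = {x : Fin 3 → ℝ | (∑ i, x i ^ 2) = 1 ∧ ∀ i, x i ∈ Rgold} ∧
    emb34 '' SigmaSet3 = SigmaSet ∩ {y : Fin 4 → ℝ | y 0 = 0} := by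
  refine ⟨SigmaSet3_eq_goldenSphere, Set.Subset.antisymm ?_ ?_⟩
  · rintro _ ⟨x, hx, rfl⟩
    exact ⟨emb34_mem_SigmaSet hx, rfl⟩
  · rintro y ⟨hy, hy0⟩
    have hy0' : y 0 = 0 := hy0
    obtain ⟨hnorm, hmem⟩ := SigmaSet_subset_goldenSphere hy
    refine ⟨fun i => y i.succ, goldenSphere_subset_SigmaSet3 ⟨?_, fun i => hmem _⟩, ?_⟩
    · simpa [Fin.sum_univ_succ _, hy0'] using hnorm
    · rw [emb34_eq_cons, ← hy0']
      exact Fin.cons_self_tail y
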